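/- Let X be a nonnegative integrable random variable supported on (0,r) with 0 < r ≤ ∞, with continuous and strictly increasing cumulative distribution function F on (0,r), and mean E[X] = β ∈ (0,r). Let α > −1 and suppose that for every p ∈ D_X = {p ∈ (0,1) : VaR_p(X) > β} the θ-index satisfies θ_p(X) = (1−p)·(α·VaR_p(X) + β)/(VaR_p(X) − β). Then for every x ∈ (β, r), ∫_x^r (1 − F(t)) dt = (αx + β)·(1 − F(x)); that is, the mean excess function of X is affine, e_X(x) = αx + β, on (β, r). -/

import Mathlib

open MeasureTheory Set

/-- Let `X` be a nonnegative integrable random variable supported on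
`(0,r)`, `0 < r ≤ ∞` (here `r : EReal`), with continuous CDF `F` which is strictly
increasing on `(0,r)`, mean `E[X] = β ∈ (0,r)`, and let `α > -1`. If for every
`p ∈ D_X = {p ∈ (0,1) : VaR_p(X) > β}` the θ-index satisfies
`θ_p(X) = (1-p)·(α·VaR_p + β)/(VaR_p - β)`, then for every `x ∈ (β, r)`,
`∫_x^r (1 - F t) dt = (αx + β)·(1 - F x)` (note `1 - F = 0` beyond `r`, so the
integral over `(x, ∞)` equals the integral over `(x, r)`); i.e. the mean excess
function of `X` is affine, `e_X(x) = αx + β`, on `(β, r)`. -/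
theorem theta_index_gp_characterization
    {Ω : Type*} [MeasurableSpace Ω] (μ : Measure Ω) [IsProbabilityMeasure μ]
    (X : Ω → ℝ) (hX : Integrable X μ)
    (r : EReal) (hr : 0 < r)
    (hsupp : ∀ᵐ ω ∂μ, 0 < X ω ∧ (X ω : EReal) < r)
    (F : ℝ → ℝ) (hF : ∀ x, F x = (μ {ω | X ω ≤ x}).toReal)
    (hFc : Continuous F)
    (hFm : StrictMonoOn F {x : ℝ | 0 < x ∧ (x : EReal) < r})
    (β : ℝ) (hmean : (∫ ω, X ω ∂μ) = β) (hβ : 0 < β) (hβr : (β : EReal) < r)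
    (α : ℝ) (hα : -1 < α)
    (VaR : ℝ → ℝ) (hVaR : ∀ p, VaR p = sInf {x | p ≤ F x})
    (ES : ℝ → ℝ) (hES : ∀ p ∈ Set.Ioo (0:ℝ) 1, ES p = (1 - p)⁻¹ * ∫ u in p..1, VaR u)
    (hθ : ∀ p ∈ Set.Ioo (0:ℝ) 1, β < VaR p →
      (1 - p) * (ES p - VaR p) / (VaR p - β)
        = (1 - p) * (α * VaR p + β) / (VaR p - β)) :
    ∀ x : ℝ, β < x → (x : EReal) < r →
      (∫ t in Set.Ioi x, (1 - F t)) = (α * x + β) * (1 - F x) := by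
  intro x hx hxr
  have hXm := hX.aemeasurable
  have hFmono : Monotone F := by
    intro a b hab
    rw [hF, hF]
    exact ENNReal.toReal_mono (measure_ne_top _ _) (measure_mono fun ω (h : X ω ≤ a) => h.trans hab)
  have hF1 : ∀ t, F t ≤ 1 := by
    intro t
    rw [hF]
    exact ENNReal.toReal_le_of_le_ofReal zero_le_one (by simpa using prob_le_one)
  have hF0 : ∀ t, 0 ≤ F t := by
    intro t
    rw [hF]
    exact ENNReal.toReal_nonneg
  have hFneg : ∀ t ≤ 0, F t = 0 := by
    intro t ht
    rw [hF]
    have : μ {ω | X ω ≤ t} = 0 := by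
      have h2 : ∀ᵐ ω ∂μ, ¬ (X ω ≤ t) := by
        filter_upwards [hsupp] with ω h
        linarith [h.1]
      simpa [ae_iff] using h2
    rw [this]; rfl
  have hlim : Filter.Tendsto F Filter.atTop (nhds 1) := by
    haveI : IsProbabilityMeasure (μ.map X) := Measure.isProbabilityMeasure_map hXm
    have h := ProbabilityTheory.tendsto_cdf_atTop (μ.map X)
    refine h.congr fun t => ?_
    rw [ProbabilityTheory.cdf_eq_real, hF, Measure.real,
      Measure.map_apply_of_aemeasurable hXm measurableSet_Iic]
    rfl
  have hgal : ∀ u ∈ Ioo (0:ℝ) 1, ∀ t, VaR u ≤ t ↔ u ≤ F t := by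
    intro u hu t
    have hbdd : BddBelow {y | u ≤ F y} := by
      refine ⟨0, fun y (hy : u ≤ F y) => ?_⟩
      by_contra hc
      have := hFneg y (not_le.mp hc).le
      linarith [hu.1]
    have hne : {y | u ≤ F y}.Nonempty := by
      obtain ⟨y, hy⟩ := (hlim.eventually (lt_mem_nhds hu.2)).exists
      exact ⟨y, le_of_lt hy⟩
    have hcl : IsClosed {y | u ≤ F y} := isClosed_le continuous_const hFc
    have hmem : u ≤ F (sInf {y | u ≤ F y}) := hcl.csInf_mem hne hbdd
    rw [hVaR]
    exact ⟨fun h => hmem.trans (hFmono h), fun h => csInf_le hbdd h⟩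
  have hx0 : 0 < x := hβ.trans hx
  set p := F x with hp
  have hlt : ∀ y, y < x → F y < p := by
    intro y hy
    obtain ⟨z, hz1, hz2⟩ := exists_between (max_lt hy hx0)
    have hz0 : 0 < z := (le_max_right _ _).trans_lt hz1
    refine (hFmono ((le_max_left _ _).trans hz1.le)).trans_lt (hFm ⟨hz0, ?_⟩ ⟨hx0, hxr⟩ hz2)
    exact (EReal.coe_lt_coe_iff.mpr hz2).trans hxr
  have hp0 : 0 < p := (hF0 _).trans_lt (hlt β hx)
  have hp1 : p < 1 := by
    obtain ⟨z, hz1, hz2⟩ := EReal.lt_iff_exists_real_btwn.mp hxr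
    have hz1' := EReal.coe_lt_coe_iff.mp hz1
    exact (hFm ⟨hx0, hxr⟩ ⟨hx0.trans hz1', hz2⟩ hz1').trans_le (hF1 _)
  have hpI : p ∈ Ioo (0:ℝ) 1 := ⟨hp0, hp1⟩
  have hVp : VaR p = x := by
    refine le_antisymm ((hgal p hpI x).2 le_rfl) ?_
    by_contra hc
    exact absurd ((hgal p hpI _).1 le_rfl) (not_le.mpr (hlt _ (not_le.mp hc)))
  have h1 := hθ p hpI (by rw [hVp]; exact hx)
  rw [hVp, hES p hpI] at h1
  have hxb : x - β ≠ 0 := by linarith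
  have hp' : 1 - p ≠ 0 := by linarith
  have h2 : (∫ u in p..1, VaR u) - (1 - p) * x = (1 - p) * (α * x + β) := by
    field_simp at h1
    linarith
  set ν : Measure ℝ := volume.restrict (Ioo p 1) with hν
  have hsub : ∀ u ∈ Ioo p 1, u ∈ Ioo (0:ℝ) 1 := fun u hu => ⟨hp0.trans hu.1, hu.2⟩
  have hVmono : MonotoneOn VaR (Ioo p 1) := by
    intro u hu v hv huv
    rw [hgal u (hsub u hu)]
    exact huv.trans ((hgal v (hsub v hv) _).1 le_rfl)
  have hVm : AEMeasurable VaR ν := aemeasurable_restrict_of_monotoneOn measurableSet_Ioo hVmono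
  have hVn : 0 ≤ᵐ[ν] fun u => VaR u - x := by
    filter_upwards [ae_restrict_mem measurableSet_Ioo] with u hu
    have : x ≤ VaR u := by
      by_contra hc
      have h3 := (hgal u (hsub u hu) _).1 (not_le.mp hc).le
      exact absurd hu.1 (not_lt.mpr h3)
    simpa using this
  have hlay : ∫⁻ u, ENNReal.ofReal (VaR u - x) ∂ν
      = ∫⁻ t in Ioi 0, ENNReal.ofReal (1 - F (t + x)) := by
    rw [lintegral_eq_lintegral_meas_lt ν hVn (hVm.sub_const x)]
    refine setLIntegral_congr_fun measurableSet_Ioi fun t ht => ?_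
    have ht : 0 < t := ht
    have hpt : p ≤ F (t + x) := hFmono (by linarith)
    have e : {u | t < VaR u - x} ∩ Ioo p 1 = Ioo (F (t + x)) 1 := by
      ext u
      constructor
      · rintro ⟨h, hu⟩
        have h : t < VaR u - x := h
        refine ⟨?_, hu.2⟩
        by_contra hc
        have := (hgal u (hsub u hu) _).2 (not_lt.mp hc)
        linarith
      · intro hu
        have hu' : u ∈ Ioo p 1 := ⟨hpt.trans_lt hu.1, hu.2⟩
        refine ⟨?_, hu'⟩
        by_contra hc
        have hc : ¬ (t < VaR u - x) := hc
        have := (hgal u (hsub u hu') (t + x)).1 (by linarith)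
        linarith [hu.1]
    simp only [hν]
    rw [Measure.restrict_apply' measurableSet_Ioo, e, Real.volume_Ioo]
  have hfin : ∫⁻ t in Ioi 0, ENNReal.ofReal (1 - F (t + x)) ≠ ⊤ := by
    have hX0 : 0 ≤ᵐ[μ] X := by
      filter_upwards [hsupp] with ω h using h.1.le
    have h3 := lintegral_eq_lintegral_meas_lt μ hX0 hXm
    have h4 : ∫⁻ ω, ENNReal.ofReal (X ω) ∂μ ≠ ⊤ := hX.lintegral_lt_top.ne
    rw [h3] at h4
    refine ne_top_of_le_ne_top h4 (lintegral_mono fun t => ?_)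
    have h5 : F t ≤ F (t + x) := hFmono (by linarith)
    have h6 : ENNReal.ofReal (1 - F t) ≤ μ {ω | t < X ω} := by
      have h7 : (1 : ENNReal) ≤ μ {ω | X ω ≤ t} + μ {ω | t < X ω} := by
        rw [← measure_univ (μ := μ)]
        refine (measure_mono ?_).trans (measure_union_le _ _)
        intro ω _
        exact le_or_gt (X ω) t
      have h8 : μ {ω | X ω ≤ t} = ENNReal.ofReal (F t) := by
        rw [hF, ENNReal.ofReal_toReal (measure_ne_top _ _)]
      rw [ENNReal.ofReal_sub _ (hF0 t), ENNReal.ofReal_one, ← h8]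
      exact tsub_le_iff_left.mpr h7
    exact (ENNReal.ofReal_le_ofReal (by linarith)).trans h6
  have hint : Integrable (fun u => VaR u - x) ν := by
    refine ⟨(hVm.sub_const x).aestronglyMeasurable, ?_⟩
    rw [hasFiniteIntegral_iff_ofReal hVn, hlay]
    exact hfin.lt_top
  have hVint : Integrable VaR ν := by
    have := hint.add (integrable_const x)
    refine this.congr (Filter.Eventually.of_forall fun u => ?_)
    simp
  have h9 : ∫ u, (VaR u - x) ∂ν = (∫ u in p..1, VaR u) - (1 - p) * x := by
    rw [integral_sub hVint (integrable_const x), intervalIntegral.integral_of_le hp1.le,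
      integral_Ioc_eq_integral_Ioo, integral_const]
    simp [hν, Measure.real, hp1.le]
  have h10 : ∫ u, (VaR u - x) ∂ν = ∫ t in Ioi 0, (1 - F (t + x)) := by
    rw [integral_eq_lintegral_of_nonneg_ae hVn (hVm.sub_const x).aestronglyMeasurable, hlay,
      integral_eq_lintegral_of_nonneg_ae]
    · exact Filter.Eventually.of_forall fun t => by simpa using hF1 (t + x)
    · exact (by fun_prop : Continuous fun t => 1 - F (t + x)).aestronglyMeasurable
  have h11 : ∫ t in Ioi 0, (1 - F (t + x)) = ∫ t in Ioi x, (1 - F t) := by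
    have := (measurePreserving_add_right (volume : Measure ℝ) x).setIntegral_preimage_emb
      (measurableEmbedding_addRight x) (fun t => 1 - F t) (Ioi x)
    simpa using this
  rw [← h11, ← h10, h9, h2]
  ring
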